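/- Let A be a left brace. If m, n are natural numbers with Aⁿ = 0 and A^{(m)} = 0, then A^{[s]} = 0 for some natural number s. -/

import Mathlib

namespace Paper

/-- A left brace: an abelian group `(A,+)` with a multiplication `bmul` that is left
distributive over addition and such that the circle operation
`a ∘ b = a·b + a + b` makes `A` into a group (the adjoint group) with identity `0`. -/
class LeftBrace (A : Type*) extends AddCommGroup A where
  bmul : A → A → A
  bmul_add : ∀ a b c : A, bmul a (b + c) = bmul a b + bmul a c
  circ_assoc : ∀ a b c : A,
    bmul (bmul a b + a + b) c + (bmul a b + a + b) + c
      = bmul a (bmul b c + b + c) + a + (bmul b c + b + c)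
  zero_circ : ∀ a : A, bmul 0 a + 0 + a = a
  circ_zero : ∀ a : A, bmul a 0 + a + 0 = a
  exists_circ_inv : ∀ a : A, ∃ b : A, bmul a b + a + b = 0 ∧ bmul b a + b + a = 0

namespace LeftBrace

variable {A : Type*} [LeftBrace A]

/-- The circle operation `a ∘ b = a·b + a + b` of a left brace. -/
def circ (a b : A) : A := bmul a b + a + b

/-- The adjoint group `A°` of a left brace: the group `(A, ∘)`. -/
noncomputable def adjointGroup (A : Type*) [LeftBrace A] : Group A where
  mul := circ
  one := (0 : A)
  inv a := Classical.choose (exists_circ_inv a)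
  mul_assoc := circ_assoc
  one_mul := zero_circ
  mul_one := circ_zero
  inv_mul_cancel a := (Classical.choose_spec (exists_circ_inv a)).2

/-- The adjoint group `A°` of the left brace `A` is a nilpotent group. -/
def AdjointNilpotent (A : Type*) [LeftBrace A] : Prop :=
  @Group.IsNilpotent A (adjointGroup A)

/-- For subsets `C, D ⊆ A`, `C · D` is the set of all finite sums `Σ cᵢ·dᵢ`
with `cᵢ ∈ C`, `dᵢ ∈ D`, i.e. the additive submonoid generated by the products. -/
def setMulSub (C D : Set A) : AddSubmonoid A :=
  AddSubmonoid.closure {x : A | ∃ c ∈ C, ∃ d ∈ D, x = bmul c d}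

/-- `C · D` as a set. -/
def setMul (C D : Set A) : Set A := (setMulSub C D : Set A)

/-- `pow A n = Aⁿ` for `n ≥ 1`: `A¹ = A`, `A^{n+1} = A · Aⁿ`.  (`pow A 0` is set to `A`.) -/
def pow (A : Type*) [LeftBrace A] : ℕ → Set A
  | 0 => Set.univ
  | 1 => Set.univ
  | (n+2) => setMul Set.univ (pow A (n+1))

/-- `rpow A n = A^{(n)}` for `n ≥ 1`: `A^{(1)} = A`, `A^{(n+1)} = A^{(n)} · A`.
(`rpow A 0` is set to `A`.) -/
def rpow (A : Type*) [LeftBrace A] : ℕ → Set A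
  | 0 => Set.univ
  | 1 => Set.univ
  | (n+2) => setMul (rpow A (n+1)) Set.univ

/-- `brk A n = A^{[n]}` for `n ≥ 1`: `A^{[1]} = A`,
`A^{[n+1]} = Σ_{i=1}^{n} A^{[i]} · A^{[n+1-i]}`.  (`brk A 0` is set to `A`.) -/
def brk (A : Type*) [LeftBrace A] : ℕ → Set A
  | 0 => Set.univ
  | 1 => Set.univ
  | (n+2) =>
    (((Finset.range (n+1)).attach.sup
      (fun i => setMulSub (brk A (i.1 + 1)) (brk A (n + 1 - i.1)))) : AddSubmonoid A)
  decreasing_by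
  · have h := i.2; simp only [Finset.mem_range] at h; omega
  · omega


/-- The product of a family of left braces, with componentwise operations. -/
noncomputable def piBrace {ι : Type*} (B : ι → Type*) (instB : ∀ i, LeftBrace (B i)) :
    LeftBrace (∀ i, B i) :=
  letI : ∀ i, LeftBrace (B i) := instB
  { (inferInstance : AddCommGroup (∀ i, B i)) with
    bmul := fun f g i => bmul (f i) (g i)
    bmul_add := fun a b c => funext fun i => bmul_add (a i) (b i) (c i)
    circ_assoc := fun a b c => funext fun i => circ_assoc (a i) (b i) (c i)
    zero_circ := fun a => funext fun i => zero_circ (a i)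
    circ_zero := fun a => funext fun i => circ_zero (a i)
    exists_circ_inv := fun a =>
      ⟨fun i => Classical.choose (exists_circ_inv (a i)),
        funext fun i => (Classical.choose_spec (exists_circ_inv (a i))).1,
        funext fun i => (Classical.choose_spec (exists_circ_inv (a i))).2⟩ }

/-- An isomorphism of left braces: an additive isomorphism preserving the brace
multiplication. -/
structure BraceIso (A B : Type*) [LeftBrace A] [LeftBrace B] extends A ≃+ B where
  map_bmul : ∀ a b : A, toAddEquiv (bmul a b) = bmul (toAddEquiv a) (toAddEquiv b)

/-- `A` is the direct sum of (finitely many) left braces whose cardinalities are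
powers of prime numbers. -/
def IsPrimePowerDirectSum (A : Type*) [LeftBrace A] : Prop :=
  ∃ (k : ℕ) (B : Fin k → Type) (instB : ∀ i, LeftBrace (B i)),
    (∀ i, ∃ p m : ℕ, p.Prime ∧ Nat.card (B i) = p ^ m) ∧
    Nonempty (@BraceIso A (∀ i, B i) _ (piBrace B instB))


theorem bmul_zero (a : A) : bmul a 0 = 0 := by
  have h := bmul_add a 0 0
  simpa using h

theorem bmul_neg (a b : A) : bmul a (-b) = -bmul a b := by
  have h := bmul_add a b (-b)
  rw [add_neg_cancel, bmul_zero] at h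
  exact (neg_eq_of_add_eq_zero_right h.symm).symm

theorem bmul_circ (a b c : A) :
    bmul (circ a b) c = bmul a (bmul b c) + bmul a c + bmul b c := by
  have h := circ_assoc a b c
  simp only [bmul_add] at h
  unfold circ
  rw [← sub_eq_zero] at h ⊢
  rw [← h]
  abel

/-- Left multiplication by `a` of a product `b · c`, in terms of the conjugate of `b` by `a`. -/
theorem exists_conj (a b : A) : ∃ a' : A, ∀ c : A,
    bmul a (bmul b c) =
      bmul (bmul a (bmul b a') + bmul b a' + bmul a b + b) (bmul a c + c) - bmul b c := by
  obtain ⟨a', h, h'⟩ := exists_circ_inv a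
  refine ⟨a', fun c => ?_⟩
  have hconj : bmul a (bmul b a') + bmul b a' + bmul a b + b = circ (circ a b) a' := by
    rw [circ, bmul_circ, circ, ← sub_eq_zero, ← neg_eq_zero, ← h]
    abel
  have hc : circ (circ (circ a b) a') a = circ a b := by
    have h1 : circ (circ (circ a b) a') a = circ (circ a b) (circ a' a) :=
      circ_assoc (circ a b) a' a
    have h2 : circ a' a = 0 := h'
    rw [h1, h2]
    exact circ_zero _
  have h3 := bmul_circ (circ (circ a b) a') a c
  rw [hc, bmul_circ] at h3
  rw [hconj, bmul_add, eq_sub_iff_add_eq]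
  rw [← sub_eq_zero] at h3 ⊢
  rw [← h3]
  abel

theorem bmul_mem_setMul {C D : Set A} {c d : A} (hc : c ∈ C) (hd : d ∈ D) :
    bmul c d ∈ setMul C D :=
  AddSubmonoid.subset_closure ⟨c, hc, d, hd, rfl⟩

theorem zero_mem_rpow (m : ℕ) : (0 : A) ∈ rpow A (m + 1) := by
  cases m with
  | zero => simp [rpow]
  | succ m => exact (setMulSub (rpow A (m + 1)) Set.univ).zero_mem

theorem add_mem_rpow (m : ℕ) {x y : A} (hx : x ∈ rpow A (m + 1)) (hy : y ∈ rpow A (m + 1)) :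
    x + y ∈ rpow A (m + 1) := by
  cases m with
  | zero => simp [rpow]
  | succ m => exact (setMulSub (rpow A (m + 1)) Set.univ).add_mem hx hy

theorem neg_mem_rpow (m : ℕ) {x : A} (hx : x ∈ rpow A (m + 1)) : -x ∈ rpow A (m + 1) := by
  cases m with
  | zero => simp [rpow]
  | succ m =>
    change x ∈ AddSubmonoid.closure _ at hx
    induction hx using AddSubmonoid.closure_induction with
    | mem x hx =>
      obtain ⟨c, hc, d, -, rfl⟩ := hx
      rw [← bmul_neg]
      exact bmul_mem_setMul hc (Set.mem_univ _)
    | zero => simpa using zero_mem_rpow (m + 1)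
    | add x y _ _ hx hy =>
      rw [neg_add]
      exact add_mem_rpow (m + 1) hx hy

theorem bmul_mem_rpow_succ (m : ℕ) {x : A} (hx : x ∈ rpow A (m + 1)) (a : A) :
    bmul x a ∈ rpow A (m + 2) :=
  bmul_mem_setMul hx (Set.mem_univ a)

theorem rpow_succ_subset (m : ℕ) : rpow A (m + 2) ⊆ rpow A (m + 1) := by
  induction m with
  | zero => simp [rpow]
  | succ m ih =>
    exact AddSubmonoid.closure_mono fun x ⟨c, hc, d, hd, h⟩ => ⟨c, ih hc, d, hd, h⟩

/-- Each `A^{(m)}` is a left ideal. -/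
theorem bmul_mem_rpow (m : ℕ) (a : A) {x : A} (hx : x ∈ rpow A (m + 1)) :
    bmul a x ∈ rpow A (m + 1) := by
  induction m generalizing a x with
  | zero => simp [rpow]
  | succ m ih =>
    change x ∈ AddSubmonoid.closure _ at hx
    induction hx using AddSubmonoid.closure_induction with
    | mem x hx =>
      obtain ⟨b, hb, c, -, rfl⟩ := hx
      obtain ⟨a', h⟩ := exists_conj a b
      have hba : bmul b a' ∈ rpow A (m + 1) := rpow_succ_subset m (bmul_mem_rpow_succ m hb a')
      rw [h, sub_eq_add_neg]
      exact add_mem_rpow (m + 1)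
        (bmul_mem_rpow_succ m
          (add_mem_rpow m (add_mem_rpow m (add_mem_rpow m (ih a hba) hba) (ih a hb)) hb) _)
        (neg_mem_rpow (m + 1) (bmul_mem_rpow_succ m hb c))
    | zero =>
      rw [bmul_zero]
      exact zero_mem_rpow (m + 1)
    | add x y _ _ hx hy =>
      rw [bmul_add]
      exact add_mem_rpow (m + 1) hx hy

theorem zero_mem_pow (n : ℕ) : (0 : A) ∈ pow A (n + 1) := by
  cases n with
  | zero => simp [pow]
  | succ n => exact (setMulSub Set.univ (pow A (n + 1))).zero_mem

theorem add_mem_pow (n : ℕ) {x y : A} (hx : x ∈ pow A (n + 1)) (hy : y ∈ pow A (n + 1)) :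
    x + y ∈ pow A (n + 1) := by
  cases n with
  | zero => simp [pow]
  | succ n => exact (setMulSub Set.univ (pow A (n + 1))).add_mem hx hy

/-- The additive submonoid `A^{(m+1)} + A^{n+1}`. -/
def rpowAddPow (A : Type*) [LeftBrace A] (m n : ℕ) : AddSubmonoid A where
  carrier := {z | ∃ x ∈ rpow A (m + 1), ∃ y ∈ pow A (n + 1), z = x + y}
  zero_mem' := ⟨0, zero_mem_rpow m, 0, zero_mem_pow n, (add_zero 0).symm⟩
  add_mem' := by
    rintro _ _ ⟨x, hx, y, hy, rfl⟩ ⟨x', hx', y', hy', rfl⟩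
    exact ⟨x + x', add_mem_rpow m hx hx', y + y', add_mem_pow n hy hy', add_add_add_comm ..⟩

theorem bmul_mem_rpowAddPow {m n : ℕ} (a : A) {z : A} (hz : z ∈ rpowAddPow A m n) :
    bmul a z ∈ rpowAddPow A m (n + 1) := by
  obtain ⟨x, hx, y, hy, rfl⟩ := hz
  exact ⟨_, bmul_mem_rpow m a hx, _, bmul_mem_setMul (Set.mem_univ a) hy, bmul_add a x y⟩

theorem brk_subset_of_bmul_mem {k : ℕ} {S : AddSubmonoid A}
    (h : ∀ i ≤ k, ∀ c ∈ brk A (i + 1), ∀ d ∈ brk A (k + 1 - i), bmul c d ∈ S) :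
    brk A (k + 2) ⊆ S := by
  rw [brk]
  refine SetLike.coe_subset_coe.2 (Finset.sup_le fun i _ => AddSubmonoid.closure_le.2 ?_)
  rintro _ ⟨c, hc, d, hd, rfl⟩
  exact h i.1 (Nat.le_of_lt_succ (Finset.mem_range.1 i.2)) c hc d hd

theorem exists_brk_subset_rpowAddPow {m s : ℕ} (hs : ∀ k ≥ s, brk A k ⊆ rpow A (m + 1))
    (n : ℕ) : ∃ t, ∀ k ≥ t, brk A k ⊆ rpowAddPow A (m + 1) n := by
  induction n with
  | zero =>
    exact ⟨0, fun k _ z _ => ⟨0, zero_mem_rpow (m + 1), z, by simp [pow], (zero_add z).symm⟩⟩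
  | succ n ih =>
    obtain ⟨t, ht⟩ := ih
    refine ⟨t + s + 2, fun k hk => ?_⟩
    obtain ⟨k, rfl⟩ : ∃ l, k = l + 2 := ⟨k - 2, by omega⟩
    refine brk_subset_of_bmul_mem fun i hi c hc d hd => ?_
    rcases le_or_gt s (i + 1) with h | h
    · exact ⟨_, bmul_mem_rpow_succ m (hs _ h hc) d, 0, zero_mem_pow (n + 1), (add_zero _).symm⟩
    · exact bmul_mem_rpowAddPow c (ht _ (by omega) hd)

/-- If `Aⁿ = 0` for some `n`, then every `A^{(m)}` contains all `A^{[k]}` with `k` large. -/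
theorem exists_brk_subset_rpow {n : ℕ} (h : pow A (n + 1) = {0}) (m : ℕ) :
    ∃ s, ∀ k ≥ s, brk A k ⊆ rpow A (m + 1) := by
  induction m with
  | zero => exact ⟨0, by simp [rpow]⟩
  | succ m ih =>
    obtain ⟨s, hs⟩ := ih
    obtain ⟨t, ht⟩ := exists_brk_subset_rpowAddPow hs n
    refine ⟨t, fun k hk z hz => ?_⟩
    obtain ⟨x, hx, y, hy, rfl⟩ := ht k hk hz
    rw [h, Set.mem_singleton_iff] at hy
    rwa [hy, add_zero]

theorem zero_mem_brk (k : ℕ) : (0 : A) ∈ brk A k := by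
  match k with
  | 0 => simp [brk]
  | 1 => simp [brk]
  | k + 2 =>
    rw [brk]
    exact AddSubmonoid.zero_mem _

/-- If `A` is a left brace with `Aⁿ = 0` and `A^{(m)} = 0` for some
natural numbers `m, n`, then `A^{[s]} = 0` for some `s`. -/
theorem leftBrace_brk_eq_bot_of_pow_rpow
    (A : Type) [LeftBrace A] (m n : ℕ) (hm : 1 ≤ m) (hn : 1 ≤ n)
    (h1 : pow A n = {0}) (h2 : rpow A m = {0}) :
    ∃ s : ℕ, 1 ≤ s ∧ brk A s = {0} := by
  obtain ⟨m, rfl⟩ := Nat.exists_eq_add_of_le' hm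
  obtain ⟨n, rfl⟩ := Nat.exists_eq_add_of_le' hn
  obtain ⟨s, hs⟩ := exists_brk_subset_rpow h1 m
  refine ⟨s + 1, Nat.le_add_left 1 s, Set.Subset.antisymm ?_ ?_⟩
  · rw [← h2]
    exact hs _ (Nat.le_succ s)
  · exact Set.singleton_subset_iff.2 (zero_mem_brk _)

end LeftBrace

end Paper
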